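/- arXiv:1404.5722 — 2 statements merged into one kernel-verified Lean document; each statement's English description precedes it below -/
import Mathlib

section
/- Let n ≥ 3 and fix integers j and t with t > 0. If some invariant of degree d of the binary form of degree n takes a nonzero value at a form ∑_{i=0}^{n} a_i x^{n−i} y^i with the property that every index i with a_i ≠ 0 satisfies i ≡ j (mod t), then d·(n−2j) ≡ 0 (mod 2t). -/
set_option synthInstance.maxHeartbeats 1000000
noncomputable section

open MvPolynomial

/-- The binary form of degree `n` with coefficient vector `a`, as a polynomial in two
variables `X 0 = x`, `X 1 = y`. -/
def formPoly (n : ℕ) (a : Fin (n+1) → ℂ) : MvPolynomial (Fin 2) ℂ :=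
  ∑ i : Fin (n+1), C (a i) * X 0 ^ (n - (i : ℕ)) * X 1 ^ (i : ℕ)

/-- The action of `SL(2,ℂ)` on coefficient vectors of binary forms of degree `n`,
given by linear substitution of the variables `x`, `y`. -/
def sl2Act (n : ℕ) (g : Matrix.SpecialLinearGroup (Fin 2) ℂ) (a : Fin (n+1) → ℂ) :
    Fin (n+1) → ℂ := fun i =>
  coeff (Finsupp.single 0 (n - (i : ℕ)) + Finsupp.single 1 (i : ℕ))
    (bind₁ (fun j : Fin 2 => C (g.1 j 0) * X 0 + C (g.1 j 1) * X 1) (formPoly n a))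

/-- The ring of invariants `I_n` of the binary form of degree `n`: the subalgebra of
`ℂ[a_0,…,a_n]` of polynomials invariant under the `SL(2,ℂ)`-action. -/
def invariantRing (n : ℕ) : Subalgebra ℂ (MvPolynomial (Fin (n+1)) ℂ) where
  carrier := {p | ∀ g : Matrix.SpecialLinearGroup (Fin 2) ℂ, ∀ a : Fin (n+1) → ℂ,
    eval (sl2Act n g a) p = eval a p}
  mul_mem' := by
    intro p q hp hq g a
    simp only [Set.mem_setOf_eq, map_mul] at *
    rw [hp g a, hq g a]
  add_mem' := by
    intro p q hp hq g a
    simp only [Set.mem_setOf_eq, map_add] at *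
    rw [hp g a, hq g a]
  algebraMap_mem' := by
    intro c g a
    simp

/-- `IsHSOP n d p` says that `p` is a homogeneous system of parameters of the invariant
ring of the binary form of degree `n`, with degree sequence `d` : the `p k` are
homogeneous of positive degrees `d k`, algebraically independent over `ℂ`, and `I_n` is a
finitely generated module over the subalgebra they generate. -/
def IsHSOP (n : ℕ) (d : Fin (n-2) → ℕ) (p : Fin (n-2) → invariantRing n) : Prop :=
  (∀ k, 0 < d k) ∧
  (∀ k, ((p k : MvPolynomial (Fin (n+1)) ℂ)).IsHomogeneous (d k)) ∧
  AlgebraicIndependent ℂ p ∧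
  Module.Finite (Algebra.adjoin ℂ (Set.range p)) (invariantRing n)

/-- The element `diag(u, u⁻¹)` of the maximal torus of `SL(2,ℂ)`. -/
def diagSL2 (u : ℂ) (hu : u ≠ 0) : Matrix.SpecialLinearGroup (Fin 2) ℂ :=
  ⟨!![u, 0; 0, u⁻¹], by simp [Matrix.det_fin_two, hu]⟩

theorem sl2Act_diagSL2 (n : ℕ) (u : ℂ) (hu : u ≠ 0) (a : Fin (n+1) → ℂ) (i : Fin (n+1)) :
    sl2Act n (diagSL2 u hu) a i = u ^ ((n : ℤ) - 2 * (i : ℕ)) * a i := by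
  have hterm (k : Fin (n+1)) :
      (C (a k) * (C u * X 0) ^ (n - (k : ℕ)) * (C u⁻¹ * X 1) ^ (k : ℕ) : MvPolynomial ℕ ℂ) =
        monomial (Finsupp.single (0 : ℕ) (n - (k : ℕ)) + Finsupp.single 1 (k : ℕ))
          (a k * u ^ (n - (k : ℕ)) * u⁻¹ ^ (k : ℕ)) := by
    rw [← mul_one (a k * u ^ (n - (k : ℕ)) * u⁻¹ ^ (k : ℕ)), ← C_mul_monomial,
      ← one_mul (1 : ℂ), ← monomial_mul, ← X_pow_eq_monomial, ← X_pow_eq_monomial]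
    simp only [map_mul, map_pow, mul_pow]
    ring
  have hinj (k : Fin (n+1)) :
      (Finsupp.single (0 : ℕ) (n - (k : ℕ)) + Finsupp.single 1 (k : ℕ) =
        Finsupp.single 0 (n - (i : ℕ)) + Finsupp.single 1 (i : ℕ)) ↔ k = i := by
    refine ⟨fun h => Fin.ext ?_, fun h => by rw [h]⟩
    simpa using DFunLike.congr_fun h 1
  have hpow : u ^ ((n : ℤ) - 2 * (i : ℕ)) = u ^ (n - (i : ℕ)) * u⁻¹ ^ (i : ℕ) := by
    rw [← zpow_natCast, ← zpow_natCast, inv_zpow', ← zpow_add₀ hu]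
    congr 1
    omega
  have hbind : bind₁ (fun j : Fin 2 => (C ((diagSL2 u hu).1 j 0) * X 0 +
      C ((diagSL2 u hu).1 j 1) * X 1 : MvPolynomial ℕ ℂ)) (formPoly n a) =
      ∑ k : Fin (n+1), (C (a k) * (C u * X 0) ^ (n - (k : ℕ)) * (C u⁻¹ * X 1) ^ (k : ℕ) :
        MvPolynomial ℕ ℂ) := by
    simp [formPoly, diagSL2, bind₁_X_right]
  rw [sl2Act, hbind]
  simp only [hterm, coeff_sum, coeff_monomial, hinj, Finset.sum_ite_eq', Finset.mem_univ,
    if_true, hpow]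
  ring

theorem MvPolynomial.IsHomogeneous.eval_mul_left {σ R : Type*} [CommSemiring R]
    {p : MvPolynomial σ R} {d : ℕ} (hp : p.IsHomogeneous d) (c : R) (a : σ → R) :
    eval (fun i => c * a i) p = c ^ d * eval a p := by
  rw [eval_eq, eval_eq, Finset.mul_sum]
  refine Finset.sum_congr rfl fun m hm => ?_
  have hdeg : ∑ i ∈ m.support, m i = d := by
    simpa [Finsupp.weight_apply, Finsupp.sum] using hp (mem_support_iff.1 hm)
  rw [← hdeg]
  simp only [mul_pow, Finset.prod_mul_distrib, Finset.prod_pow_eq_pow_sum]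
  ring

theorem stmt_0 (n : ℕ) (hn : 3 ≤ n) (j t : ℤ) (ht : 0 < t) (d : ℕ)
    (p : MvPolynomial (Fin (n+1)) ℂ) (hinv : p ∈ invariantRing n)
    (hhom : p.IsHomogeneous d) (a : Fin (n+1) → ℂ)
    (ha : ∀ i : Fin (n+1), a i ≠ 0 → t ∣ ((i : ℕ) : ℤ) - j)
    (hne : eval a p ≠ 0) :
    2 * t ∣ (d : ℤ) * ((n : ℤ) - 2 * j) := by
  have ht2 : 2 * t.toNat ≠ 0 := by omega
  have hζ := Complex.isPrimitiveRoot_exp _ ht2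
  set u := Complex.exp (2 * Real.pi * Complex.I / (2 * t.toNat : ℕ))
  have hu : u ≠ 0 := Complex.exp_ne_zero _
  have hcast : ((2 * t.toNat : ℕ) : ℤ) = 2 * t := by omega
  have hact : sl2Act n (diagSL2 u hu) a = fun i => u ^ ((n : ℤ) - 2 * j) * a i := by
    funext i
    rw [sl2Act_diagSL2]
    by_cases hi : a i = 0
    · simp [hi]
    obtain ⟨k, hk⟩ := ha i hi
    have hexp : (n : ℤ) - 2 * (i : ℕ) = (n - 2 * j) + 2 * t * (-k) := by
      linear_combination -2 * hk
    have hone : u ^ (2 * t * (-k)) = 1 :=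
      (hζ.zpow_eq_one_iff_dvd _).2 (hcast ▸ dvd_mul_right _ _)
    rw [hexp, zpow_add₀ hu, hone, mul_one]
  have heval := hinv (diagSL2 u hu) a
  rw [hact, hhom.eval_mul_left, mul_eq_right₀ hne, ← zpow_natCast, ← zpow_mul] at heval
  rw [← hcast, mul_comm (d : ℤ)]
  exact (hζ.zpow_eq_one_iff_dvd _).1 heval
end
end

section
/- Let n ≥ 3 and fix integers j and t with t > 1 and 0 ≤ j ≤ n. If (d_1,…,d_{n−2}) is the degree sequence of a hsop of I_n, then at least ⌊(n−j)/t⌋ of the indices k satisfy d_k·(n−2j) ≡ 0 (mod 2t). -/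
set_option synthInstance.maxHeartbeats 1000000
noncomputable section

open MvPolynomial

open Finset in
/-- The coefficient of `u ^ (card ι - k) * v ^ k` in the product of linear forms
`∏ i, (α i * u + β i * v)`. -/
def prodLinearCoeff {ι R : Type*} [Fintype ι] [DecidableEq ι] [CommRing R]
    (α β : ι → R) (k : ℕ) : R :=
  ∑ s ∈ powersetCard k (univ : Finset ι), (∏ i ∈ s, β i) * ∏ i ∈ sᶜ, α i

section ProdLinearCoeff

variable {ι R : Type*} [Fintype ι] [DecidableEq ι] [CommRing R]

lemma prod_linear_eq_sum (α β : ι → R) (u v : R) :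
    ∏ i, (α i * u + β i * v) =
      ∑ k : Fin (Fintype.card ι + 1),
        prodLinearCoeff α β k * u ^ (Fintype.card ι - (k : ℕ)) * v ^ (k : ℕ) := by
  rw [Finset.prod_congr rfl fun i _ => add_comm (α i * u) (β i * v), Finset.prod_add,
    Finset.sum_powerset, Finset.sum_range, Finset.card_univ]
  refine Finset.sum_congr rfl fun k _ => ?_
  rw [prodLinearCoeff, Finset.sum_mul, Finset.sum_mul]
  refine Finset.sum_congr rfl fun s hs => ?_
  have hs' : s.card = k := (Finset.mem_powersetCard.1 hs).2
  rw [← Finset.compl_eq_univ_sdiff, Finset.prod_mul_distrib, Finset.prod_mul_distrib,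
    Finset.prod_const, Finset.prod_const, Finset.card_compl, hs']
  ring

lemma coeff_prod_linear (α β : ι → R) (k : Fin (Fintype.card ι + 1)) :
    (∏ i, (Polynomial.C (α i) + Polynomial.C (β i) * Polynomial.X)).coeff k =
      prodLinearCoeff α β k := by
  have hmap (i : ℕ) : prodLinearCoeff (fun i => Polynomial.C (α i))
      (fun i => Polynomial.C (β i)) i = Polynomial.C (prodLinearCoeff α β i) := by
    simp [prodLinearCoeff]
  have h := prod_linear_eq_sum (fun i => Polynomial.C (α i)) (fun i => Polynomial.C (β i))
    1 Polynomial.X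
  simp only [mul_one, one_pow, hmap] at h
  rw [h, Polynomial.finsetSum_coeff]
  simp [Polynomial.coeff_C_mul, Polynomial.coeff_X_pow, Fin.val_inj]

lemma prodLinearCoeff_comp_equiv {κ : Type*} [Fintype κ] [DecidableEq κ] (e : κ ≃ ι)
    (α β : ι → R) (k : Fin (Fintype.card ι + 1)) :
    prodLinearCoeff (α ∘ e) (β ∘ e) (k : ℕ) = prodLinearCoeff α β (k : ℕ) := by
  have hc := Fintype.card_congr e
  rw [← coeff_prod_linear α β k, ← Equiv.prod_comp e]
  exact (coeff_prod_linear (α ∘ e) (β ∘ e) (Fin.cast (by rw [hc]) k)).symm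

lemma prodLinearCoeff_smul (μ α β : ι → R) (k : ℕ) :
    prodLinearCoeff (μ * α) (μ * β) k = (∏ i, μ i) * prodLinearCoeff α β k := by
  rw [prodLinearCoeff, prodLinearCoeff, Finset.mul_sum]
  refine Finset.sum_congr rfl fun s _ => ?_
  simp only [Pi.mul_apply, Finset.prod_mul_distrib]
  rw [← Finset.prod_mul_prod_compl s μ]
  ring

lemma prodLinearCoeff_zero (α β : ι → R) : prodLinearCoeff α β 0 = ∏ i, α i := by
  simp [prodLinearCoeff]

lemma prodLinearCoeff_one (β : ι → R) (k : ℕ) :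
    prodLinearCoeff 1 β k = ∑ s ∈ Finset.powersetCard k Finset.univ, ∏ i ∈ s, β i := by
  simp [prodLinearCoeff]

lemma map_prodLinearCoeff {S F : Type*} [CommRing S] [FunLike F R S] [RingHomClass F R S]
    (f : F) (α β : ι → R) (k : ℕ) :
    f (prodLinearCoeff α β k) = prodLinearCoeff (fun i => f (α i)) (fun i => f (β i)) k := by
  simp [prodLinearCoeff]

end ProdLinearCoeff

lemma exists_eq_C_mul_prod_linear {ι K : Type*} [Field K] [IsAlgClosed K] (s : Finset ι)
    (f : Polynomial K) (hf : f.natDegree ≤ s.card) :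
    ∃ (c : K) (α β : ι → K),
      f = Polynomial.C c * ∏ i ∈ s, (Polynomial.C (α i) + Polynomial.C (β i) * Polynomial.X) := by
  classical
  induction s using Finset.induction_on generalizing f with
  | empty =>
    exact ⟨f.coeff 0, 0, 0, by simpa using Polynomial.eq_C_of_natDegree_le_zero (by simpa using hf)⟩
  | insert i s hi ih =>
    rw [Finset.card_insert_of_notMem hi] at hf
    obtain ⟨g, a, b, hg, hfg⟩ : ∃ (g : Polynomial K) (a b : K), g.natDegree ≤ s.card ∧
        f = g * (Polynomial.C a + Polynomial.C b * Polynomial.X) := by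
      by_cases hd : f.natDegree ≤ s.card
      · exact ⟨f, 1, 0, hd, by simp⟩
      · obtain ⟨r, hr⟩ := IsAlgClosed.exists_root f
          (by rw [Polynomial.degree_eq_natDegree (by rintro rfl; simp at hd)]; norm_cast; omega)
        obtain ⟨g, rfl⟩ := Polynomial.dvd_iff_isRoot.2 hr
        have hg : g ≠ 0 := by rintro rfl; simp at hd
        rw [Polynomial.natDegree_mul (Polynomial.X_sub_C_ne_zero r) hg,
          Polynomial.natDegree_X_sub_C] at hf
        refine ⟨g, -r, 1, by omega, ?_⟩
        rw [map_neg, map_one]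
        ring
    obtain ⟨c, α, β, hαβ⟩ := ih g hg
    refine ⟨c, Function.update α i a, Function.update β i b, ?_⟩
    rw [Finset.prod_insert hi, hfg, hαβ]
    simp only [Function.update_self]
    have hprod : ∏ k ∈ s, (Polynomial.C (Function.update α i a k) +
        Polynomial.C (Function.update β i b k) * Polynomial.X) =
        ∏ k ∈ s, (Polynomial.C (α k) + Polynomial.C (β k) * Polynomial.X) :=
      Finset.prod_congr rfl fun k hk => by
        rw [Function.update_of_ne (ne_of_mem_of_not_mem hk hi),
          Function.update_of_ne (ne_of_mem_of_not_mem hk hi)]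
    rw [hprod]
    ring

lemma exists_prodLinearCoeff_eq {ι K : Type*} [Field K] [IsAlgClosed K] [Fintype ι]
    [DecidableEq ι] [Nonempty ι] (a : Fin (Fintype.card ι + 1) → K) :
    ∃ α β : ι → K, (fun k : Fin (Fintype.card ι + 1) => prodLinearCoeff α β (k : ℕ)) = a := by
  set f : Polynomial K := ∑ k : Fin (Fintype.card ι + 1), Polynomial.C (a k) * Polynomial.X ^ (k : ℕ)
    with hf
  have hfd : f.natDegree ≤ Fintype.card ι :=
    Polynomial.natDegree_sum_le_of_forall_le _ _ fun k _ =>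
      (Polynomial.natDegree_C_mul_X_pow_le _ _).trans (by omega)
  obtain ⟨c, α, β, h⟩ := exists_eq_C_mul_prod_linear (Finset.univ : Finset ι) f hfd
  obtain ⟨z, hz⟩ := IsAlgClosed.exists_pow_nat_eq c (Fintype.card_pos (α := ι))
  refine ⟨(fun _ => z) * α, (fun _ => z) * β, funext fun k => ?_⟩
  rw [prodLinearCoeff_smul, ← coeff_prod_linear, Finset.prod_const, Finset.card_univ, hz,
    ← Polynomial.coeff_C_mul, ← h, hf, Polynomial.finsetSum_coeff]
  simp [Polynomial.coeff_C_mul, Polynomial.coeff_X_pow, Fin.val_inj]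

lemma X_dvd_of_eval_eq_zero {σ K : Type*} [Field K] [Infinite K] {i : σ}
    {p : MvPolynomial σ K} (h : ∀ a : σ → K, a i = 0 → eval a p = 0) : X i ∣ p := by
  classical
  have hdvd : ∀ q : MvPolynomial σ K, X i ∣ q - bind₁ (Function.update X i 0) q := by
    intro q
    induction q using MvPolynomial.induction_on with
    | C c => simp
    | add q r hq hr =>
      rw [map_add, add_sub_add_comm]
      exact dvd_add hq hr
    | mul_X q j hq =>
      rw [map_mul, bind₁_X_right]
      rcases eq_or_ne j i with rfl | hj
      · simp
      · rw [Function.update_of_ne hj, ← sub_mul]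
        exact hq.mul_right _
  have hzero : bind₁ (Function.update X i 0) p = 0 := by
    refine MvPolynomial.funext_iff.2 fun a => ?_
    rw [map_zero, ← h (Function.update a i 0) (Function.update_self ..), ← coe_aeval_eq_eval,
      ← coe_aeval_eq_eval]
    simp only [RingHom.coe_coe, aeval_bind₁]
    congr 2
    funext j
    rcases eq_or_ne j i with rfl | hj
    · simp
    · simp [hj]
  simpa [hzero] using hdvd p

lemma exists_homogenization {n : ℕ} {K : Type*} [Field K] (S : MvPolynomial (Fin n) K) :
    ∃ (D : ℕ) (p : MvPolynomial (Fin (n + 1)) K), ∀ a : Fin (n + 1) → K, a 0 ≠ 0 →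
      eval a p = a 0 ^ D * eval (fun i => a i.succ / a 0) S := by
  induction S using MvPolynomial.induction_on with
  | C c => exact ⟨0, C c, by simp⟩
  | add q r hq hr =>
    obtain ⟨D, p, hp⟩ := hq
    obtain ⟨D', p', hp'⟩ := hr
    refine ⟨D + D', p * X 0 ^ D' + p' * X 0 ^ D, fun a ha => ?_⟩
    simp only [map_add, map_mul, map_pow, eval_X, hp a ha, hp' a ha]
    ring
  | mul_X q i hq =>
    obtain ⟨D, p, hp⟩ := hq
    refine ⟨D + 1, p * X i.succ, fun a ha => ?_⟩
    simp only [map_mul, eval_X, hp a ha]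
    field_simp
    ring

lemma eval_eq_of_eval_eq_of_prod_ne_zero {ι : Type*} [Fintype ι]
    {P Q : MvPolynomial (ι ⊕ ι) ℂ}
    (h : ∀ α β : ι → ℂ, ∏ i, α i ≠ 0 → eval (Sum.elim α β) P = eval (Sum.elim α β) Q)
    (α β : ι → ℂ) : eval (Sum.elim α β) P = eval (Sum.elim α β) Q := by
  have hmul : (∏ i : ι, X (Sum.inl i)) * P = (∏ i : ι, X (Sum.inl i)) * Q := by
    refine MvPolynomial.funext_iff.2 fun x => ?_
    rw [← Sum.elim_comp_inl_inr x, map_mul, map_mul]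
    by_cases hx : ∏ i, (x ∘ Sum.inl) i = 0
    · have : eval (Sum.elim (x ∘ Sum.inl) (x ∘ Sum.inr))
          (∏ i : ι, (X (Sum.inl i) : MvPolynomial (ι ⊕ ι) ℂ)) = 0 := by
        rw [← hx]
        simp
      rw [this, zero_mul, zero_mul]
    · rw [h _ _ hx]
  rw [mul_left_cancel₀ (Finset.prod_ne_zero_iff.2 fun i _ => X_ne_zero _) hmul]

section Multisymmetric

variable {ι : Type*} [Fintype ι] [DecidableEq ι]

/-- The coefficient vector of the binary form `∏ i, (α i * x + β i * y)`. -/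
abbrev prodLinearForm {R : Type*} [CommRing R] (α β : ι → R) : Fin (Fintype.card ι + 1) → R :=
  fun k => prodLinearCoeff α β k

lemma eval_bind₁_prodLinearForm (p : MvPolynomial (Fin (Fintype.card ι + 1)) ℂ) (α β : ι → ℂ) :
    eval (Sum.elim α β) (bind₁ (prodLinearForm (fun i => X (Sum.inl i)) fun i => X (Sum.inr i)) p) =
      eval (prodLinearForm α β) p := by
  rw [← coe_aeval_eq_eval, ← coe_aeval_eq_eval]
  simp only [RingHom.coe_coe, aeval_bind₁]
  congr 2
  funext k
  rw [map_prodLinearCoeff]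
  simp

lemma exists_eval_prodLinearForm_eq_of_prod_pow_mul [Nonempty ι] (Q : MvPolynomial (ι ⊕ ι) ℂ)
    (D : ℕ) (p : MvPolynomial (Fin (Fintype.card ι + 1)) ℂ)
    (hp : ∀ α β : ι → ℂ,
      eval (prodLinearForm α β) p = (∏ i, α i) ^ D * eval (Sum.elim α β) Q) :
    ∃ q : MvPolynomial (Fin (Fintype.card ι + 1)) ℂ, ∀ α β : ι → ℂ,
      eval (prodLinearForm α β) q = eval (Sum.elim α β) Q := by
  induction D generalizing p with
  | zero => exact ⟨p, by simpa using hp⟩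
  | succ D ih =>
    obtain ⟨q, rfl⟩ : X 0 ∣ p := X_dvd_of_eval_eq_zero fun a ha => by
      obtain ⟨α, β, rfl⟩ := exists_prodLinearCoeff_eq a
      replace ha : ∏ i, α i = 0 := by rwa [← prodLinearCoeff_zero α β]
      rw [hp, ha]
      simp
    refine ih q fun α β => ?_
    have key := eval_eq_of_eval_eq_of_prod_ne_zero (ι := ι)
      (P := bind₁ (prodLinearForm (fun i => X (Sum.inl i)) fun i => X (Sum.inr i)) q)
      (Q := (∏ i, X (Sum.inl i)) ^ D * Q) (fun α β hα => by
        have h := hp α β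
        rw [map_mul, eval_X, prodLinearForm, Fin.val_zero, prodLinearCoeff_zero, pow_succ',
          mul_assoc] at h
        rw [eval_bind₁_prodLinearForm, mul_left_cancel₀ hα h]
        simp) α β
    rw [← eval_bind₁_prodLinearForm, key]
    simp

/-- A polynomial in the coefficients of `card ι` linear forms which is symmetric and
multihomogeneous is a polynomial in the coefficients of their product. -/
lemma exists_eval_prodLinearForm_eq [Nonempty ι] (Q : MvPolynomial (ι ⊕ ι) ℂ) (d : ℕ)
    (hsymm : ∀ (σ : Equiv.Perm ι) (α β : ι → ℂ),
      eval (Sum.elim (α ∘ σ) (β ∘ σ)) Q = eval (Sum.elim α β) Q)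
    (hhom : ∀ μ α β : ι → ℂ,
      eval (Sum.elim (μ * α) (μ * β)) Q = (∏ i, μ i) ^ d * eval (Sum.elim α β) Q) :
    ∃ q : MvPolynomial (Fin (Fintype.card ι + 1)) ℂ, ∀ α β : ι → ℂ,
      eval (prodLinearForm α β) q = eval (Sum.elim α β) Q := by
  set q : MvPolynomial ι ℂ := bind₁ (Sum.elim 1 X) Q with hq
  have hqeval (β : ι → ℂ) : eval β q = eval (Sum.elim 1 β) Q := by
    rw [hq, ← coe_aeval_eq_eval, ← coe_aeval_eq_eval]
    simp only [RingHom.coe_coe, aeval_bind₁]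
    congr 2
    funext k
    rcases k with k | k <;> simp
  have hqsymm : q.IsSymmetric := fun σ => by
    refine MvPolynomial.funext_iff.2 fun β => ?_
    rw [eval_rename, hqeval, hqeval, ← hsymm σ 1 β]
    rfl
  obtain ⟨S, hS⟩ := esymmAlgHom_surjective ℂ (le_refl (Fintype.card ι)) ⟨q, hqsymm⟩
  have hSq (β : ι → ℂ) : eval β q = eval (fun i : Fin (Fintype.card ι) => prodLinearCoeff 1 β (i + 1)) S := by
    rw [← show (esymmAlgHom ι ℂ (Fintype.card ι) S : MvPolynomial ι ℂ) = q by rw [hS],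
      esymmAlgHom_apply, ← coe_aeval_eq_eval, ← coe_aeval_eq_eval]
    simp only [RingHom.coe_coe]
    rw [comp_aeval_apply]
    simp [prodLinearCoeff_one, esymm]
  obtain ⟨D, p, hp⟩ := exists_homogenization S
  refine exists_eval_prodLinearForm_eq_of_prod_pow_mul Q D (p * X 0 ^ d) fun α β => ?_
  have key := eval_eq_of_eval_eq_of_prod_ne_zero (ι := ι)
    (P := bind₁ (prodLinearForm (fun i => X (Sum.inl i)) fun i => X (Sum.inr i)) (p * X 0 ^ d))
    (Q := (∏ i, X (Sum.inl i)) ^ D * Q) (fun α β hα => by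
      have hα' : ∀ i, α i ≠ 0 := fun i => Finset.prod_ne_zero_iff.1 hα i (Finset.mem_univ i)
      have hα1 : α * 1 = α := mul_one α
      have hαβ : α * (β / α) = β := funext fun i => mul_div_cancel₀ _ (hα' i)
      have h0 : prodLinearForm α β 0 = ∏ i, α i := prodLinearCoeff_zero α β
      have hdiv : (fun i : Fin (Fintype.card ι) => prodLinearForm α β i.succ / ∏ i, α i) =
          fun i : Fin (Fintype.card ι) => prodLinearCoeff 1 (β / α) (i + 1) := funext fun i => by
        rw [div_eq_iff hα, mul_comm, ← prodLinearCoeff_smul, hα1, hαβ]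
        rfl
      have hh := hhom α 1 (β / α)
      rw [hα1, hαβ] at hh
      rw [eval_bind₁_prodLinearForm, map_mul, hp _ (by rwa [h0]), map_pow, eval_X, h0, hdiv,
        ← hSq, hqeval, map_mul, hh]
      simp only [map_pow, map_prod, eval_X, Sum.elim_inl]
      ring) α β
  rw [← eval_bind₁_prodLinearForm, key]
  simp

end Multisymmetric

lemma coeff_formPoly (n : ℕ) (a : Fin (n + 1) → ℂ) (i : Fin (n + 1)) :
    coeff (Finsupp.single 0 (n - (i : ℕ)) + Finsupp.single 1 (i : ℕ)) (formPoly n a) = a i := by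
  have hmon (k : Fin (n + 1)) : (C (a k) * X 0 ^ (n - (k : ℕ)) * X 1 ^ (k : ℕ) :
      MvPolynomial (Fin 2) ℂ) =
      monomial (Finsupp.single 0 (n - (k : ℕ)) + Finsupp.single 1 (k : ℕ)) (a k) := by
    rw [X_pow_eq_monomial, X_pow_eq_monomial, C_mul_monomial, monomial_mul, mul_one, mul_one]
  rw [formPoly, coeff_sum, Finset.sum_eq_single i]
  · rw [hmon, coeff_monomial, if_pos rfl]
  · intro k _ hk
    rw [hmon, coeff_monomial, if_neg]
    intro h
    have h1 := DFunLike.congr_fun h 1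
    simp only [Finsupp.add_apply, Finsupp.single_apply, Fin.zero_eq_one_iff,
      OfNat.ofNat_ne_one, if_false, if_true, zero_add] at h1
    exact hk (Fin.ext h1)
  · simp

section Invariants

variable {ι : Type*} [Fintype ι] [DecidableEq ι]

lemma formPoly_prodLinearForm (α β : ι → ℂ) :
    formPoly (Fintype.card ι) (prodLinearForm α β) = ∏ i, (C (α i) * X 0 + C (β i) * X 1) := by
  rw [prod_linear_eq_sum, formPoly]
  simp_rw [map_prodLinearCoeff]

lemma sl2Act_prodLinearForm (g : Matrix.SpecialLinearGroup (Fin 2) ℂ) (α β : ι → ℂ) :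
    sl2Act (Fintype.card ι) g (prodLinearForm α β) =
      prodLinearForm (fun i => g.1 0 0 * α i + g.1 1 0 * β i)
        (fun i => g.1 0 1 * α i + g.1 1 1 * β i) := by
  funext k
  refine Eq.trans ?_ (coeff_formPoly _ _ k)
  unfold sl2Act
  rw [formPoly_prodLinearForm, formPoly_prodLinearForm, map_prod,
    ← coeff_rename_mapDomain (Fin.val : Fin 2 → ℕ) Fin.val_injective, map_prod,
    Finsupp.mapDomain_add, Finsupp.mapDomain_single, Finsupp.mapDomain_single]
  refine congrArg (coeff (R := ℂ) (σ := ℕ) _) (Finset.prod_congr rfl fun i _ => ?_)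
  simp only [map_add, map_mul, bind₁_X_right, algHom_C, algebraMap_eq, rename_X, Fin.val_zero,
    Fin.val_one]
  ring

/-- A symmetric, multihomogeneous and `SL(2,ℂ)`-invariant polynomial in the coefficients of
linear forms comes from an invariant of their product. -/
lemma exists_mem_invariantRing [Nonempty ι] (Q : MvPolynomial (ι ⊕ ι) ℂ) (d : ℕ)
    (hsymm : ∀ (σ : Equiv.Perm ι) (α β : ι → ℂ),
      eval (Sum.elim (α ∘ σ) (β ∘ σ)) Q = eval (Sum.elim α β) Q)
    (hhom : ∀ μ α β : ι → ℂ,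
      eval (Sum.elim (μ * α) (μ * β)) Q = (∏ i, μ i) ^ d * eval (Sum.elim α β) Q)
    (hinv : ∀ (g : Matrix.SpecialLinearGroup (Fin 2) ℂ) (α β : ι → ℂ),
      eval (Sum.elim (fun i => g.1 0 0 * α i + g.1 1 0 * β i)
        (fun i => g.1 0 1 * α i + g.1 1 1 * β i)) Q = eval (Sum.elim α β) Q) :
    ∃ q ∈ invariantRing (Fintype.card ι),
      bind₁ (prodLinearForm (fun i => X (Sum.inl i)) fun i => X (Sum.inr i)) q = Q := by
  obtain ⟨q, hq⟩ := exists_eval_prodLinearForm_eq Q d hsymm hhom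
  refine ⟨q, fun g a => ?_, MvPolynomial.funext_iff.2 fun x => ?_⟩
  · obtain ⟨α, β, rfl⟩ := exists_prodLinearCoeff_eq a
    rw [sl2Act_prodLinearForm, hq, hinv, hq]
  · rw [← Sum.elim_comp_inl_inr x, eval_bind₁_prodLinearForm, hq]

end Invariants

section Bracket

variable {ι : Type*} [Fintype ι]

/-- The product of the brackets `[a b] = α a * β b - α b * β a` with multiplicities `w a b`. -/
def bracketMonomial {R : Type*} [CommRing R] (w : ι → ι → ℕ) (α β : ι → R) : R :=
  ∏ a, ∏ b, (α a * β b - α b * β a) ^ w a b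

lemma map_bracketMonomial {R S F : Type*} [CommRing R] [CommRing S] [FunLike F R S]
    [RingHomClass F R S] (f : F) (w : ι → ι → ℕ) (α β : ι → R) :
    f (bracketMonomial w α β) = bracketMonomial w (fun i => f (α i)) (fun i => f (β i)) := by
  simp [bracketMonomial]

lemma bracketMonomial_add {R : Type*} [CommRing R] (v w : ι → ι → ℕ) (α β : ι → R) :
    bracketMonomial (v + w) α β = bracketMonomial v α β * bracketMonomial w α β := by
  simp [bracketMonomial, pow_add, Finset.prod_mul_distrib]

lemma bracketMonomial_smul {R : Type*} [CommRing R] {w : ι → ι → ℕ} {d : ℕ}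
    (hw : ∀ a, ∑ b, (w a b + w b a) = d) (μ α β : ι → R) :
    bracketMonomial w (μ * α) (μ * β) = (∏ i, μ i) ^ d * bracketMonomial w α β := by
  have hμ : ∏ a, ∏ b, (μ a * μ b) ^ w a b = (∏ i, μ i) ^ d := by
    simp_rw [mul_pow, Finset.prod_mul_distrib]
    rw [Finset.prod_comm (f := fun a b => μ b ^ w a b)]
    simp_rw [Finset.prod_pow_eq_pow_sum]
    rw [← Finset.prod_mul_distrib, ← Finset.prod_pow]
    simp_rw [← pow_add, ← Finset.sum_add_distrib, hw]
  rw [← hμ, bracketMonomial, bracketMonomial]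
  simp_rw [← Finset.prod_mul_distrib, ← mul_pow, Pi.mul_apply]
  refine Finset.prod_congr rfl fun a _ => Finset.prod_congr rfl fun b _ => ?_
  congr 1
  ring

lemma bracketMonomial_linear {R : Type*} [CommRing R] (w : ι → ι → ℕ)
    {g₀₀ g₀₁ g₁₀ g₁₁ : R} (hg : g₀₀ * g₁₁ - g₀₁ * g₁₀ = 1) (α β : ι → R) :
    bracketMonomial w (fun i => g₀₀ * α i + g₁₀ * β i) (fun i => g₀₁ * α i + g₁₁ * β i) =
      bracketMonomial w α β := by
  refine Finset.prod_congr rfl fun a _ => Finset.prod_congr rfl fun b _ => ?_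
  congr 1
  linear_combination (α a * β b - α b * β a) * hg

lemma mem_of_forall_prodLinearCoeff_mem {κ k K : Type*} [Field k] [Field K] [Algebra k K]
    [Fintype κ] [DecidableEq κ] (F : IntermediateField k K) (hF : ∀ x, IsAlgebraic F x → x ∈ F)
    (x : κ → K) (h : ∀ i : Fin (Fintype.card κ + 1), prodLinearCoeff 1 x i ∈ F) (a : κ) :
    x a ∈ F := by
  set f : Polynomial F := ∑ i : Fin (Fintype.card κ + 1),
    Polynomial.C ⟨_, h i⟩ * Polynomial.X ^ (Fintype.card κ - (i : ℕ)) * (-1) ^ (i : ℕ) with hf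
  have hmap : f.map (algebraMap F K) = ∏ b, (Polynomial.X - Polynomial.C (x b)) := by
    have h1 := prod_linear_eq_sum (fun _ => Polynomial.C (1 : K)) (fun b => Polynomial.C (x b))
      Polynomial.X (-1)
    simp_rw [← map_prodLinearCoeff] at h1
    rw [hf, Polynomial.map_sum]
    simp only [Polynomial.map_mul, Polynomial.map_C, Polynomial.map_pow, Polynomial.map_X,
      Polynomial.map_neg, Polynomial.map_one]
    refine h1.symm.trans (Finset.prod_congr rfl fun b _ => ?_)
    rw [map_one]
    ring
  refine hF _ ⟨f, fun h0 => ?_, ?_⟩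
  · rw [h0, Polynomial.map_zero] at hmap
    exact (Polynomial.monic_prod_of_monic _ _ fun b _ => Polynomial.monic_X_sub_C (x b)).ne_zero
      hmap.symm
  · rw [← Polynomial.eval_map_algebraMap, hmap, Polynomial.eval_prod]
    exact Finset.prod_eq_zero (Finset.mem_univ a) (by simp)

lemma prodLinearCoeff_one_mul {κ R : Type*} [Fintype κ] [DecidableEq κ] [CommRing R] (c : R)
    (x : κ → R) (k : ℕ) :
    prodLinearCoeff 1 (fun i => c * x i) k = c ^ k * prodLinearCoeff 1 x k := by
  rw [prodLinearCoeff_one, prodLinearCoeff_one, Finset.mul_sum]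
  refine Finset.sum_congr rfl fun s hs => ?_
  rw [Finset.prod_mul_distrib, Finset.prod_const, (Finset.mem_powersetCard.1 hs).2]

/-- Regular bracket monomials are algebraic over the invariants. -/
lemma bracketMonomial_mem [DecidableEq ι] [Nonempty ι] {K : Type*} [Field K] [Algebra ℂ K]
    (F : IntermediateField ℂ K) (hF : ∀ x, IsAlgebraic F x → x ∈ F) (α β : ι → K)
    (h : ∀ p ∈ invariantRing (Fintype.card ι), aeval (prodLinearForm α β) p ∈ F)
    {w : ι → ι → ℕ} {d : ℕ} (hw : ∀ a, ∑ b, (w a b + w b a) = d) :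
    bracketMonomial w α β ∈ F := by
  refine mem_of_forall_prodLinearCoeff_mem F hF
    (fun σ : Equiv.Perm ι => bracketMonomial w (α ∘ σ) (β ∘ σ)) (fun k => ?_) 1
  set Q : MvPolynomial (ι ⊕ ι) ℂ := prodLinearCoeff 1 (fun σ : Equiv.Perm ι =>
    bracketMonomial w (fun i => X (Sum.inl (σ i))) (fun i => X (Sum.inr (σ i)))) k with hQ
  have hQeval (α β : ι → ℂ) : eval (Sum.elim α β) Q = prodLinearCoeff 1
      (fun σ : Equiv.Perm ι => bracketMonomial w (α ∘ σ) (β ∘ σ)) k := by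
    rw [hQ, map_prodLinearCoeff]
    simp only [map_bracketMonomial, eval_X, Sum.elim_inl, Sum.elim_inr, Pi.one_apply, map_one]
    rfl
  have hQaeval : aeval (Sum.elim α β) Q = prodLinearCoeff 1
      (fun σ : Equiv.Perm ι => bracketMonomial w (α ∘ σ) (β ∘ σ)) k := by
    rw [hQ, map_prodLinearCoeff]
    simp only [map_bracketMonomial, aeval_X, Sum.elim_inl, Sum.elim_inr, Pi.one_apply, map_one]
    rfl
  obtain ⟨q, hq, hqQ⟩ := exists_mem_invariantRing Q (d * k) (fun τ α β => by
      rw [hQeval, hQeval]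
      exact prodLinearCoeff_comp_equiv (Equiv.mulLeft τ) 1
        (fun σ : Equiv.Perm ι => bracketMonomial w (α ∘ σ) (β ∘ σ)) k)
    (fun μ α β => by
      rw [hQeval, hQeval, pow_mul, ← prodLinearCoeff_one_mul]
      congr 1
      funext σ
      rw [← Equiv.prod_comp σ μ, ← bracketMonomial_smul hw]
      rfl)
    (fun g α β => by
      rw [hQeval, hQeval]
      congr 1
      funext σ
      exact bracketMonomial_linear w ((Matrix.det_fin_two g.1).symm.trans g.2) (α ∘ σ) (β ∘ σ))
  rw [← hQaeval, ← hqQ, aeval_bind₁]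
  convert h q hq using 3
  funext i
  rw [map_prodLinearCoeff]
  simp

end Bracket

section Switch

variable {ι : Type*} [Fintype ι] [DecidableEq ι]

lemma bracketMonomial_single {R : Type*} [CommRing R] (a b : ι) (α β : ι → R) :
    bracketMonomial (Pi.single a (Pi.single b 1)) α β = α a * β b - α b * β a := by
  rw [bracketMonomial, Finset.prod_eq_single a, Finset.prod_eq_single b]
  · simp
  · intro c _ hc
    simp [hc]
  · simp
  · intro c _ hc
    simp [hc]
  · simp

lemma sum_single_add_single (a b x : ι) :
    ∑ y, ((Pi.single a (Pi.single b 1) : ι → ι → ℕ) x y +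
      (Pi.single a (Pi.single b 1) : ι → ι → ℕ) y x) =
      (Pi.single a 1 : ι → ℕ) x + (Pi.single b 1 : ι → ℕ) x := by
  rw [Finset.sum_add_distrib]
  congr 1
  · rcases eq_or_ne x a with rfl | hx
    · simp
    · simp [hx]
  · rw [Finset.sum_eq_single a]
    · simp
    · intro y _ hy
      simp [hy]
    · simp

/-- Moving the edges `ab`, `ce` of a regular multigraph to `ac`, `be` keeps it regular, so the
cross ratio is algebraic over the invariants. -/
lemma cross_ratio_mem [Nonempty ι] {K : Type*} [Field K] [Algebra ℂ K]
    (F : IntermediateField ℂ K) (hF : ∀ x, IsAlgebraic F x → x ∈ F) (α β : ι → K)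
    (h : ∀ p ∈ invariantRing (Fintype.card ι), aeval (prodLinearForm α β) p ∈ F)
    {w : ι → ι → ℕ} {d : ℕ} (hw : ∀ a, ∑ b, (w a b + w b a) = d)
    (hne : bracketMonomial w α β ≠ 0) {a b c e : ι} (hac : a ≠ c)
    (hab : w a b ≠ 0) (hce : w c e ≠ 0) :
    (α a * β b - α b * β a) * (α c * β e - α e * β c) /
      ((α a * β c - α c * β a) * (α b * β e - α e * β b)) ∈ F := by
  let δ (a b : ι) : ι → ι → ℕ := Pi.single a (Pi.single b 1)
  obtain ⟨v, hv⟩ : ∃ v, w = v + δ a b + δ c e := by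
    refine ⟨fun x y => w x y - δ a b x y - δ c e x y, funext fun x => funext fun y => ?_⟩
    have hle : δ a b x y + δ c e x y ≤ w x y := by
      rcases eq_or_ne x a with rfl | hxa
      · rcases eq_or_ne y b with rfl | hyb
        · simp [δ, hac]
          omega
        · simp [δ, hac, hyb]
      · rcases eq_or_ne x c with rfl | hxc
        · rcases eq_or_ne y e with rfl | hye
          · simp [δ, hxa]
            omega
          · simp [δ, hxa, hye]
        · simp [δ, hxa, hxc]
    simp only [Pi.add_apply]
    omega
  have hreg : ∀ x, ∑ y, ((v + δ a c + δ b e) x y + (v + δ a c + δ b e) y x) = d := fun x => by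
    have hx := hw x
    have hsum (a b c e : ι) : ∑ y, ((v + δ a b + δ c e) x y + (v + δ a b + δ c e) y x) =
        ∑ y, (v x y + v y x) + ((Pi.single a 1 : ι → ℕ) x + (Pi.single b 1 : ι → ℕ) x) +
          ((Pi.single c 1 : ι → ℕ) x + (Pi.single e 1 : ι → ℕ) x) := by
      rw [← sum_single_add_single, ← sum_single_add_single, ← Finset.sum_add_distrib,
        ← Finset.sum_add_distrib]
      refine Finset.sum_congr rfl fun y _ => ?_
      simp only [Pi.add_apply, δ]
      ring
    rw [hv, hsum] at hx
    rw [hsum]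
    omega
  have h1 := bracketMonomial_mem F hF α β h hw
  have h2 := bracketMonomial_mem F hF α β h hreg
  rw [hv] at h1 hne
  simp only [bracketMonomial_add, δ, bracketMonomial_single, mul_assoc] at h1 h2 hne
  rw [← mul_div_mul_left _ _ (left_ne_zero_of_mul hne)]
  exact F.div_mem h1 h2

end Switch

section Star

variable {N t j r : ℕ} {R : Type*} [CommRing R]

/-- The linear forms `x + ζ ^ l * s i * y`, together with `j` copies of `y` and `r` copies of `x`:
coefficients of `x`. -/
def starLeft (N t j r : ℕ) (R : Type*) [CommRing R] : (Fin N × Fin t) ⊕ (Fin j ⊕ Fin r) → R :=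
  Sum.elim 1 (Sum.elim 0 1)

/-- The linear forms `x + ζ ^ l * s i * y`, together with `j` copies of `y` and `r` copies of `x`:
coefficients of `y`. -/
def starRight (t j r : ℕ) (ζ : R) (s : Fin N → R) : (Fin N × Fin t) ⊕ (Fin j ⊕ Fin r) → R :=
  Sum.elim (fun u => ζ ^ (u.2 : ℕ) * s u.1) (Sum.elim 1 0)

lemma eval_smul_of_isHomogeneous {σ : Type*} {p : MvPolynomial σ R} {d : ℕ}
    (hp : p.IsHomogeneous d) (c : R) (x : σ → R) : eval (c • x) p = c ^ d * eval x p := by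
  rw [eval_eq, eval_eq, Finset.mul_sum]
  refine Finset.sum_congr rfl fun m hm => ?_
  have hd : m.degree = d := by
    rw [← hp (mem_support_iff.1 hm), Finsupp.degree_eq_weight_one]
    rfl
  simp only [Pi.smul_apply, smul_eq_mul, mul_pow, Finset.prod_mul_distrib,
    Finset.prod_pow_eq_pow_sum]
  rw [← hd, Finsupp.degree_apply]
  ring

lemma eval_star_eq_zero (ht : 0 < t) {d : ℕ}
    {p : MvPolynomial (Fin (Fintype.card ((Fin N × Fin t) ⊕ (Fin j ⊕ Fin r)) + 1)) ℂ}
    (hp : p ∈ invariantRing _) (hpd : p.IsHomogeneous d) {z : ℂ} (hz : IsPrimitiveRoot z (2 * t))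
    (hd : ¬ (2 * t : ℤ) ∣ d * ((N * t + r : ℤ) - j)) (s : Fin N → ℂ) :
    eval (prodLinearForm (starLeft N t j r ℂ) (starRight t j r (z ^ 2) s)) p = 0 := by
  have : NeZero t := ⟨ht.ne'⟩
  have hz0 : z ≠ 0 := hz.ne_zero (by omega)
  let g : Matrix.SpecialLinearGroup (Fin 2) ℂ := ⟨!![z⁻¹, 0; 0, z], by simp [hz0]⟩
  let μ : (Fin N × Fin t) ⊕ (Fin j ⊕ Fin r) → ℂ :=
    Sum.elim (fun _ => z⁻¹) (Sum.elim (fun _ => z) (fun _ => z⁻¹))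
  let e : (Fin N × Fin t) ⊕ (Fin j ⊕ Fin r) ≃ (Fin N × Fin t) ⊕ (Fin j ⊕ Fin r) :=
    Equiv.sumCongr (Equiv.prodCongr (Equiv.refl _) (Equiv.addRight 1)) (Equiv.refl _)
  have hζt : (z ^ 2) ^ t = 1 := by rw [← pow_mul, hz.pow_eq_one]
  have hrot (l : Fin t) : (z ^ 2) ^ ((l + 1 : Fin t) : ℕ) = z ^ 2 * (z ^ 2) ^ (l : ℕ) := by
    rw [Fin.val_add, Fin.val_one', Nat.add_mod_mod, ← pow_eq_pow_mod _ hζt, pow_succ']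
  have hleft : (fun i => g.1 0 0 * starLeft N t j r ℂ i +
      g.1 1 0 * starRight t j r (z ^ 2) s i) = μ * (starLeft N t j r ℂ ∘ e) := by
    funext i
    rcases i with i | i | i <;> simp [g, μ, e, starLeft, starRight]
  have hright : (fun i => g.1 0 1 * starLeft N t j r ℂ i +
      g.1 1 1 * starRight t j r (z ^ 2) s i) = μ * (starRight t j r (z ^ 2) s ∘ e) := by
    funext i
    rcases i with i | i | i
    · simp only [g, μ, e, starRight, Pi.mul_apply, Function.comp_apply, Equiv.sumCongr_apply,
        Sum.map_inl, Sum.elim_inl, Equiv.prodCongr_apply, Equiv.coe_addRight]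
      simp
      field_simp
      rw [hrot]
      ring
    · simp [g, μ, e, starRight]
    · simp [g, μ, e, starRight]
  have hμ : ∏ i, μ i = z ^ ((j : ℤ) - (N * t + r)) := by
    rw [zpow_sub₀ hz0]
    simp [μ]
    norm_cast
    field_simp
    ring
  have h := hp g (prodLinearForm (starLeft N t j r ℂ) (starRight t j r (z ^ 2) s))
  rw [sl2Act_prodLinearForm, hleft, hright] at h
  have hform : prodLinearForm (μ * (starLeft N t j r ℂ ∘ e))
      (μ * (starRight t j r (z ^ 2) s ∘ e)) =
      (∏ i, μ i) • prodLinearForm (starLeft N t j r ℂ) (starRight t j r (z ^ 2) s) := by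
    funext k
    rw [prodLinearForm, prodLinearCoeff_smul, prodLinearCoeff_comp_equiv]
    rfl
  rw [hform, eval_smul_of_isHomogeneous hpd, hμ, ← zpow_natCast, ← zpow_mul] at h
  by_contra h0
  have h1 := mul_right_cancel₀ h0 (h.trans (one_mul _).symm)
  rw [hz.zpow_eq_one_iff_dvd] at h1
  obtain ⟨c, hc⟩ := h1
  exact hd ⟨-c, by push_cast at hc; linarith⟩

end Star

section StarWeight

variable {N t j r : ℕ}

/-- A symmetric weight on pairs of linear forms: `A` on pairs of distinct forms
`x + ζ ^ l * s i * y`, `B` and `C` on pairs of such a form and `x` resp. `y`, `E` on pairs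
of `x` and `y`. -/
def starWeight (N t j r A B C E : ℕ) :
    (Fin N × Fin t) ⊕ (Fin j ⊕ Fin r) → (Fin N × Fin t) ⊕ (Fin j ⊕ Fin r) → ℕ
  | .inl u, .inl v => if u = v then 0 else A
  | .inl _, .inr (.inl _) => C
  | .inl _, .inr (.inr _) => B
  | .inr (.inl _), .inl _ => C
  | .inr (.inr _), .inl _ => B
  | .inr (.inl _), .inr (.inr _) => E
  | .inr (.inr _), .inr (.inl _) => E
  | .inr (.inl _), .inr (.inl _) => 0
  | .inr (.inr _), .inr (.inr _) => 0

lemma starWeight_comm (A B C E : ℕ) (a b : (Fin N × Fin t) ⊕ (Fin j ⊕ Fin r)) :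
    starWeight N t j r A B C E a b = starWeight N t j r A B C E b a := by
  rcases a with a | a | a <;> rcases b with b | b | b <;> simp [starWeight, eq_comm]

lemma sum_starWeight {A B C E D : ℕ} (hA : (N * t - 1) * A + j * C + r * B = D)
    (hC : N * t * C + r * E = D) (hB : N * t * B + j * E = D)
    (a : (Fin N × Fin t) ⊕ (Fin j ⊕ Fin r)) :
    ∑ b, starWeight N t j r A B C E a b = D := by
  rcases a with a | a | a
  · have hsum : ∑ v, (if a = v then 0 else A) = (N * t - 1) * A := by
      rw [Finset.sum_ite, Finset.sum_const_zero, zero_add, Finset.sum_const, smul_eq_mul,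
        Finset.filter_ne, Finset.card_erase_of_mem (Finset.mem_univ _)]
      simp
    simp [starWeight, hsum, ← hA, add_assoc]
  · simp [starWeight, ← hC]
  · simp [starWeight, ← hB]

lemma exists_starWeight_regular (hN : 0 < N) (hj : j < t) (hr : r < t) :
    ∃ A B C E D : ℕ, 0 < A ∧ ∀ a, ∑ b, (starWeight N t j r A B C E a b +
      starWeight N t j r A B C E b a) = D := by
  have hM : t ≤ N * t := Nat.le_mul_of_pos_left t hN
  obtain ⟨m, hm⟩ : ∃ m, N * t = m + 1 := ⟨N * t - 1, by omega⟩
  obtain ⟨j', hj'⟩ : ∃ j', m + 1 = j + j' := ⟨m + 1 - j, by omega⟩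
  obtain ⟨r', hr'⟩ : ∃ r', m + 1 = r + r' := ⟨m + 1 - r, by omega⟩
  refine ⟨r' * j' + r * j, m * j', m * r', (m + 1) * m, 2 * (m * ((m + 1) * (m + 1))), ?_,
    fun a => ?_⟩
  · have : 0 < r' * j' := Nat.mul_pos (by omega) (by omega)
    omega
  · rw [Finset.sum_add_distrib]
    simp_rw [fun b => starWeight_comm (N := N) (t := t) (j := j) (r := r) (r' * j' + r * j)
      (m * j') (m * r') ((m + 1) * m) b a]
    rw [sum_starWeight (D := m * ((m + 1) * (m + 1))), ← two_mul]
    · rw [hm, Nat.add_sub_cancel]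
      nth_rewrite 1 [hj']
      rw [hr']
      ring
    · rw [hm]
      nth_rewrite 4 [hr']
      ring
    · rw [hm]
      nth_rewrite 4 [hj']
      ring

end StarWeight

section StarAlgebraic

variable {N t j r : ℕ} {K : Type*} [Field K] {ζ : K} {s : Fin N → K}

lemma bracketMonomial_starWeight_ne_zero
    (hs : Function.Injective fun u : Fin N × Fin t => ζ ^ (u.2 : ℕ) * s u.1) (hs0 : ∀ i, s i ≠ 0)
    (hζ : ζ ≠ 0) (A B C E : ℕ) :
    bracketMonomial (starWeight N t j r A B C E) (starLeft N t j r K) (starRight t j r ζ s) ≠ 0 := by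
  refine Finset.prod_ne_zero_iff.2 fun a _ => Finset.prod_ne_zero_iff.2 fun b _ => ?_
  rcases a with a | a | a <;> rcases b with b | b | b
  · by_cases hab : a = b
    · simp [starWeight, hab]
    · refine pow_ne_zero _ ?_
      simpa [starLeft, starRight, sub_eq_zero] using fun h => hab (hs h).symm
  all_goals simp [starWeight, starLeft, starRight, hs0, hζ]

/-- The ratio of `x` and `y` is algebraic over their cross ratio expression. -/
lemma div_mem_of_mul_div_sq_mem [Algebra ℂ K] (F : IntermediateField ℂ K)
    (hF : ∀ x, IsAlgebraic F x → x ∈ F) {x y : K} (hx : x ≠ 0) (hy : y ≠ 0) (hxy : y ≠ x)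
    (h : x * y / (y - x) ^ 2 ∈ F) : y / x ∈ F := by
  have hxy' : y - x ≠ 0 := sub_ne_zero.2 hxy
  obtain ⟨v, hv⟩ : ∃ v : F, (v : K) = x * y / (y - x) ^ 2 := ⟨⟨_, h⟩, rfl⟩
  have hv0 : v ≠ 0 := by
    intro h0
    rw [h0] at hv
    exact div_ne_zero (mul_ne_zero hx hy) (pow_ne_zero 2 hxy') hv.symm
  refine hF _ ⟨Polynomial.C v * Polynomial.X ^ 2 - Polynomial.C (2 * v + 1) * Polynomial.X +
    Polynomial.C v, fun h0 => hv0 ?_, ?_⟩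
  · simpa using congrArg (Polynomial.coeff · 0) h0
  · have hal : algebraMap F K v = x * y / (y - x) ^ 2 := hv
    simp only [map_add, map_sub, map_mul, Polynomial.aeval_C, map_pow, Polynomial.aeval_X, hal,
      map_ofNat, map_one]
    field_simp
    ring

/-- Algebraicity of the values of the invariants forces algebraicity of the parameters. -/
lemma star_mem [Algebra ℂ K] (F : IntermediateField ℂ K) (hF : ∀ x, IsAlgebraic F x → x ∈ F)
    (hζF : ζ ∈ F) (hs : Function.Injective fun u : Fin N × Fin t => ζ ^ (u.2 : ℕ) * s u.1)
    (hs0 : ∀ i, s i ≠ 0) (hζ : ζ ≠ 0) (ht : 1 < t) (hj : j < t) (hr : r < t)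
    (h : ∀ p ∈ invariantRing (Fintype.card ((Fin N × Fin t) ⊕ (Fin j ⊕ Fin r))),
      aeval (prodLinearForm (starLeft N t j r K) (starRight t j r ζ s)) p ∈ F) (i : Fin N) :
    s i ∈ F := by
  obtain ⟨A, B, C, E, D, hA, hw⟩ := exists_starWeight_regular i.pos hj hr
  have hne := bracketMonomial_starWeight_ne_zero (j := j) (r := r) hs hs0 hζ A B C E
  let z : Fin t := ⟨0, by omega⟩
  let o : Fin t := ⟨1, ht⟩
  have : Nonempty ((Fin N × Fin t) ⊕ (Fin j ⊕ Fin r)) := ⟨.inl (i, z)⟩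
  have hzo : z ≠ o := by simp [z, o]
  have hζ1 : ζ - 1 ≠ 0 := by
    intro h1
    rw [sub_eq_zero] at h1
    have := @hs (i, z) (i, o) (by simp [h1])
    exact hzo (congrArg Prod.snd this)
  have hratio (k : Fin N) : s k / s i ∈ F := by
    rcases eq_or_ne k i with rfl | hk
    · rw [div_self (hs0 k)]
      exact F.one_mem
    have hski : s k ≠ s i := fun h1 => hk (by simpa using @hs (k, z) (i, z) (by simp [h1]))
    have hski' : s k - s i ≠ 0 := sub_ne_zero.2 hski
    have hc := cross_ratio_mem F hF _ _ h hw hne (a := .inl (i, z)) (b := .inl (i, o))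
      (c := .inl (k, z)) (e := .inl (k, o)) (by simpa using hk.symm)
      (by simp [starWeight, hzo, hA.ne']) (by simp [starWeight, hzo, hA.ne'])
    refine div_mem_of_mul_div_sq_mem F hF (hs0 i) (hs0 k) hski ?_
    have hfac : ζ / (ζ - 1) ^ 2 ∈ F :=
      F.div_mem hζF (pow_mem (F.sub_mem hζF F.one_mem) 2)
    convert F.mul_mem hfac hc using 1
    simp only [starLeft, starRight, Sum.elim_inl, Pi.one_apply, z, o, pow_zero, pow_one, one_mul]
    have h2 : ζ * s k - ζ * s i ≠ 0 := by
      rw [← mul_sub]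
      exact mul_ne_zero hζ hski'
    field_simp
  have hbr (a b : (Fin N × Fin t) ⊕ (Fin j ⊕ Fin r)) : ∃ δ : ℕ, ∃ φ ∈ F,
      starLeft N t j r K a * starRight t j r ζ s b - starLeft N t j r K b * starRight t j r ζ s a =
        s i ^ δ * φ ∧ (a = .inl (i, z) → b = .inl (i, o) → 0 < δ) := by
    have hmem (u : Fin N × Fin t) : ζ ^ (u.2 : ℕ) * (s u.1 / s i) ∈ F :=
      F.mul_mem (pow_mem hζF _) (hratio _)
    have hsi := hs0 i
    rcases a with a | a | a <;> rcases b with b | b | b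
    · refine ⟨1, _, F.sub_mem (hmem b) (hmem a), ?_, by simp⟩
      simp only [starLeft, starRight, Sum.elim_inl, Pi.one_apply]
      field_simp
    · exact ⟨0, 1, F.one_mem, by simp [starLeft, starRight], by simp⟩
    · refine ⟨1, _, F.neg_mem (hmem a), ?_, by simp⟩
      simp [starLeft, starRight]
      field_simp
    · exact ⟨0, -1, F.neg_mem F.one_mem, by simp [starLeft, starRight], by simp⟩
    · exact ⟨0, 0, F.zero_mem, by simp [starLeft, starRight], by simp⟩
    · exact ⟨0, -1, F.neg_mem F.one_mem, by simp [starLeft, starRight], by simp⟩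
    · refine ⟨1, _, hmem b, ?_, by simp⟩
      simp [starLeft, starRight]
      field_simp
    · exact ⟨0, 1, F.one_mem, by simp [starLeft, starRight], by simp⟩
    · exact ⟨0, 0, F.zero_mem, by simp [starLeft, starRight], by simp⟩
  choose δ φ hφF hφ hδ using hbr
  set w := starWeight N t j r A B C E with hw_def
  have hP : bracketMonomial w (starLeft N t j r K) (starRight t j r ζ s) =
      s i ^ (∑ a, ∑ b, δ a b * w a b) * ∏ a, ∏ b, φ a b ^ w a b := by
    simp_rw [bracketMonomial, hφ, mul_pow, Finset.prod_mul_distrib, ← pow_mul,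
      Finset.prod_pow_eq_pow_sum]
  have hm : 0 < ∑ a, ∑ b, δ a b * w a b := by
    refine Finset.sum_pos' (fun _ _ => Nat.zero_le _) ⟨.inl (i, z), Finset.mem_univ _, ?_⟩
    refine Finset.sum_pos' (fun _ _ => Nat.zero_le _) ⟨.inl (i, o), Finset.mem_univ _, ?_⟩
    refine Nat.mul_pos (hδ _ _ rfl rfl) ?_
    simp [hw_def, starWeight, hzo, hA]
  have hpow : s i ^ (∑ a, ∑ b, δ a b * w a b) ∈ F := by
    have hφ0 := right_ne_zero_of_mul (hP ▸ hne)
    rw [← mul_div_cancel_right₀ (s i ^ _) hφ0, ← hP]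
    exact F.div_mem (bracketMonomial_mem F hF _ _ h hw)
      (F.prod_mem fun a _ => F.prod_mem fun b _ => pow_mem (hφF a b) _)
  exact hF _ ((isAlgebraic_algebraMap (⟨_, hpow⟩ : F)).of_pow hm)

end StarAlgebraic

section TranscendenceDegree

open scoped IntermediateField.algebraAdjoinAdjoin

lemma le_card_of_forall_X_isAlgebraic {N : ℕ}
    (T : Finset (FractionRing (MvPolynomial (Fin N) ℂ)))
    (hX : ∀ i, IsAlgebraic (IntermediateField.adjoin ℂ
      (T : Set (FractionRing (MvPolynomial (Fin N) ℂ))))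
      (algebraMap (MvPolynomial (Fin N) ℂ) (FractionRing (MvPolynomial (Fin N) ℂ)) (X i))) :
    N ≤ T.card := by
  let K := FractionRing (MvPolynomial (Fin N) ℂ)
  let G := IntermediateField.adjoin ℂ (T : Set K)
  have hpoly (q : MvPolynomial (Fin N) ℂ) : algebraMap _ K q ∈ algebraicClosure G K := by
    induction q using MvPolynomial.induction_on with
    | C c =>
      rw [← algebraMap_eq, ← IsScalarTower.algebraMap_apply, IsScalarTower.algebraMap_apply ℂ G K]
      exact (algebraicClosure G K).algebraMap_mem _
    | add p q hp hq =>
      rw [map_add]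
      exact add_mem hp hq
    | mul_X p i hp =>
      rw [map_mul]
      exact mul_mem hp (mem_algebraicClosure_iff.2 (hX i))
  have halg : Algebra.IsAlgebraic G K := ⟨fun x => by
    obtain ⟨a, b, -, rfl⟩ := IsFractionRing.div_surjective (A := MvPolynomial (Fin N) ℂ) x
    exact mem_algebraicClosure_iff.1 (div_mem (hpoly a) (hpoly b))⟩
  have halg' : Algebra.IsAlgebraic (Algebra.adjoin ℂ (T : Set K)) K :=
    (IsFractionRing.comap_isAlgebraic_iff (K := G)).2 halg
  have hind : AlgebraicIndependent ℂ
      (fun i : Fin N => algebraMap (MvPolynomial (Fin N) ℂ) K (X i)) :=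
    (algebraicIndependent_X (Fin N) ℂ).map' (f := IsScalarTower.toAlgHom ℂ _ K)
      (IsFractionRing.injective _ K)
  have h1 := hind.cardinalMk_le_trdeg.trans
    (Algebra.IsAlgebraic.trdeg_le_cardinalMk ℂ (T : Set K))
  simpa using h1

end TranscendenceDegree

section Main

variable {N t j r n : ℕ}

lemma algebraMap_pow_mul_X_injective {ζ : ℂ} (hζ : IsPrimitiveRoot ζ t) (ht : t ≠ 0) :
    Function.Injective fun u : Fin N × Fin t =>
      algebraMap ℂ (FractionRing (MvPolynomial (Fin N) ℂ)) ζ ^ (u.2 : ℕ) *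
        algebraMap (MvPolynomial (Fin N) ℂ) (FractionRing (MvPolynomial (Fin N) ℂ)) (X u.1) := by
  intro u v h
  simp only [IsScalarTower.algebraMap_apply ℂ (MvPolynomial (Fin N) ℂ)
    (FractionRing (MvPolynomial (Fin N) ℂ)), ← map_pow, ← map_mul] at h
  have h1 := congrArg (coeff (Finsupp.single u.1 1)) (IsFractionRing.injective _ _ h)
  simp only [algebraMap_eq, coeff_C_mul, coeff_X, if_true, mul_one] at h1
  by_cases huv : v.1 = u.1
  · rw [huv, if_pos rfl, mul_one] at h1
    exact Prod.ext huv.symm (Fin.ext (hζ.pow_inj u.2.2 v.2.2 h1))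
  · rw [if_neg (fun h => huv (Finsupp.single_left_injective one_ne_zero h)), mul_zero] at h1
    exact absurd h1 (pow_ne_zero _ (hζ.ne_zero ht))

lemma map_aeval_prodLinearForm {ι R S : Type*} [Fintype ι] [DecidableEq ι] [CommRing R]
    [CommRing S] [Algebra ℂ R] [Algebra ℂ S] (f : R →ₐ[ℂ] S) (α β : ι → R)
    (p : MvPolynomial (Fin (Fintype.card ι + 1)) ℂ) :
    f (aeval (prodLinearForm α β) p) =
      aeval (prodLinearForm (fun i => f (α i)) fun i => f (β i)) p := by
  have h : prodLinearForm (fun i => f (α i)) (fun i => f (β i)) =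
      fun k => f (prodLinearForm α β k) := funext fun k => (map_prodLinearCoeff f α β k).symm
  rw [h, comp_aeval_apply]

lemma aeval_star_eq_zero (ht : 0 < t) {d : ℕ}
    {p : MvPolynomial (Fin (Fintype.card ((Fin N × Fin t) ⊕ (Fin j ⊕ Fin r)) + 1)) ℂ}
    (hp : p ∈ invariantRing _) (hpd : p.IsHomogeneous d) {z : ℂ} (hz : IsPrimitiveRoot z (2 * t))
    (hd : ¬ (2 * t : ℤ) ∣ d * ((N * t + r : ℤ) - j)) {K : Type*} [Field K] [Algebra ℂ K]
    (s : Fin N → K) :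
    aeval (prodLinearForm (starLeft N t j r K) (starRight t j r (algebraMap ℂ K (z ^ 2)) s)) p =
      0 := by
  have hX : aeval (prodLinearForm (starLeft N t j r (MvPolynomial (Fin N) ℂ))
      (starRight t j r (C (z ^ 2)) X)) p = 0 := by
    refine MvPolynomial.funext fun x => ?_
    rw [map_zero, ← eval_star_eq_zero ht hp hpd hz hd x, ← coe_aeval_eq_eval, ← coe_aeval_eq_eval,
      RingHom.coe_coe, RingHom.coe_coe, map_aeval_prodLinearForm]
    congr 3
    all_goals
      funext i
      rcases i with i | i | i <;> simp [starLeft, starRight]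
  rw [← map_zero (aeval (R := ℂ) s), ← hX, map_aeval_prodLinearForm]
  congr 3
  all_goals
    funext i
    rcases i with i | i | i <;> simp [starLeft, starRight]

lemma le_card_filter (ht : 1 < t) (hj : j < t) (hr : r < t)
    (hn : n = Fintype.card ((Fin N × Fin t) ⊕ (Fin j ⊕ Fin r)))
    (d : Fin (n - 2) → ℕ) (p : Fin (n - 2) → invariantRing n) (hp : IsHSOP n d p) :
    N ≤ (Finset.univ.filter fun k => (2 * t : ℤ) ∣ d k * ((N * t + r : ℤ) - j)).card := by
  classical
  subst hn
  obtain ⟨-, hhom, -, hfin⟩ := hp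
  have hz := Complex.isPrimitiveRoot_exp (2 * t) (by omega)
  set z := Complex.exp (2 * Real.pi * Complex.I / (2 * t : ℕ))
  have hζ : IsPrimitiveRoot (z ^ 2) t := hz.pow (by omega) rfl
  let K := FractionRing (MvPolynomial (Fin N) ℂ)
  let s : Fin N → K := fun i => algebraMap (MvPolynomial (Fin N) ℂ) K (X i)
  let ζ : K := algebraMap ℂ K (z ^ 2)
  let φ := aeval (R := ℂ) (prodLinearForm (starLeft N t j r K) (starRight t j r ζ s))
  set S := Finset.univ.filter fun k => (2 * t : ℤ) ∣ d k * ((N * t + r : ℤ) - j)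
  let T : Finset K := S.image fun k => φ (p k)
  let G := IntermediateField.adjoin ℂ (T : Set K)
  have hG (k) : φ (p k) ∈ G := by
    by_cases hk : (2 * t : ℤ) ∣ d k * ((N * t + r : ℤ) - j)
    · exact IntermediateField.subset_adjoin ℂ _
        (Finset.mem_coe.2 (Finset.mem_image_of_mem _ (Finset.mem_filter.2 ⟨Finset.mem_univ k, hk⟩)))
    · have h0 : φ (p k) = 0 := aeval_star_eq_zero (by omega) (p k).2 (hhom k) hz hk s
      rw [h0]
      exact G.zero_mem
  let F : IntermediateField ℂ K := (algebraicClosure G K).restrictScalars ℂ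
  have hF (x : K) (hx : IsAlgebraic F x) : x ∈ F := by
    have hx' : IsAlgebraic (algebraicClosure G K) x := hx
    have h1 := mem_algebraicClosure_iff.2 hx'
    rw [algebraicClosure.algebraicClosure_eq_bot, IntermediateField.mem_bot] at h1
    obtain ⟨y, rfl⟩ := h1
    exact y.2
  let ψ : invariantRing (Fintype.card ((Fin N × Fin t) ⊕ (Fin j ⊕ Fin r))) →ₐ[ℂ] K :=
    φ.comp (Subalgebra.val _)
  have hψ : ∀ q ∈ Algebra.adjoin ℂ (Set.range p), ψ q ∈ G := by
    intro q hq
    have : Algebra.adjoin ℂ (Set.range p) ≤ G.toSubalgebra.comap ψ := by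
      rw [Algebra.adjoin_le_iff]
      rintro _ ⟨k, rfl⟩
      exact hG k
    exact this hq
  have hmem : ∀ q ∈ invariantRing (Fintype.card ((Fin N × Fin t) ⊕ (Fin j ⊕ Fin r))),
      φ q ∈ F := by
    intro q hq
    have hint : IsIntegral (Algebra.adjoin ℂ (Set.range p))
        (⟨q, hq⟩ : invariantRing (Fintype.card ((Fin N × Fin t) ⊕ (Fin j ⊕ Fin r)))) :=
      Algebra.IsIntegral.isIntegral _
    let ψ' : Algebra.adjoin ℂ (Set.range p) →+* G :=
      (ψ.toRingHom.comp (algebraMap (Algebra.adjoin ℂ (Set.range p)) _)).codRestrict G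
        fun q => hψ q q.2
    have h1 : IsIntegral G (ψ ⟨q, hq⟩) := hint.map_of_comp_eq ψ' ψ.toRingHom rfl
    exact mem_algebraicClosure_iff'.2 h1
  have hs0 (i : Fin N) : s i ≠ 0 :=
    (map_ne_zero_iff _ (IsFractionRing.injective _ K)).2 (X_ne_zero i)
  have hsF := star_mem F hF (F.algebraMap_mem (z ^ 2))
    (algebraMap_pow_mul_X_injective hζ (by omega)) hs0
    ((map_ne_zero _).2 (hζ.ne_zero (by omega))) ht hj hr hmem
  exact (le_card_of_forall_X_isAlgebraic T fun i => mem_algebraicClosure_iff.1 (hsF i)).trans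
    Finset.card_image_le

end Main

theorem stmt_1 (n : ℕ) (hn : 3 ≤ n) (j t : ℤ) (ht : 1 < t)
    (hj0 : 0 ≤ j) (hjn : j ≤ (n : ℤ))
    (d : Fin (n-2) → ℕ) (p : Fin (n-2) → invariantRing n) (hp : IsHSOP n d p) :
    ((n : ℤ) - j) / t ≤
      ((Finset.univ.filter fun k => 2 * t ∣ (d k : ℤ) * ((n : ℤ) - 2 * j)).card : ℤ) := by
  lift j to ℕ using hj0
  lift t to ℕ using by omega
  have ht' : 1 < t := by exact_mod_cast ht
  have hjn' : j ≤ n := by exact_mod_cast hjn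
  have hj' : j % t < t := Nat.mod_lt _ (by omega)
  have hle : j % t ≤ j := Nat.mod_le _ _
  set N := (n - j % t) / t with hN
  set r := (n - j % t) % t with hr
  have hdiv : N * t + r = n - j % t := by
    rw [mul_comm]
    exact Nat.div_add_mod _ _
  have hcard : n = Fintype.card ((Fin N × Fin t) ⊕ (Fin (j % t) ⊕ Fin r)) := by
    simp only [Fintype.card_sum, Fintype.card_prod, Fintype.card_fin]
    omega
  have hmain := le_card_filter ht' hj' (Nat.mod_lt _ (by omega)) hcard d p hp
  have hdvd (k) : (2 * t : ℤ) ∣ d k * ((N * t + r : ℤ) - (j % t : ℕ)) ↔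
      (2 * t : ℤ) ∣ d k * ((n : ℤ) - 2 * j) := by
    have hj2 : (j : ℤ) = t * (j / t : ℕ) + (j % t : ℕ) := by
      exact_mod_cast (Nat.div_add_mod j t).symm
    have hsum : (N * t + r : ℤ) = n - (j % t : ℕ) := by
      rw [← Nat.cast_sub (hle.trans hjn')]
      exact_mod_cast hdiv
    have heq : (d k : ℤ) * ((n : ℤ) - 2 * j) = d k * ((N * t + r : ℤ) - (j % t : ℕ)) +
        2 * t * (-(d k * (j / t : ℕ))) := by
      rw [hsum, hj2]
      ring
    rw [heq, dvd_add_left (dvd_mul_right _ _)]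
  rw [Finset.filter_congr fun k _ => hdvd k] at hmain
  refine le_trans ?_ (Nat.cast_le.2 hmain)
  rw [← Nat.cast_sub hjn']
  exact_mod_cast Nat.div_le_div_right (by omega)
end
end
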